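/- arXiv:2603.02610 — 5 statements merged into one kernel-verified Lean document; each statement's English description precedes it below -/
import Mathlib

section
/- Let N ≥ 2, let S_1,…,S_N be nonnegative integers, let B be a nonnegative integer, and let 𝒳 be the set of nonnegative-integer vectors x = (x_{ij})_{i<j} indexed by unordered pairs of nodes such that Σ_{i<j} x_{ij} ≤ B and, for every node i, Σ_{j<i} x_{ji} + Σ_{j>i} x_{ij} ≤ S_i. Then the maximum of Σ_{i<j} x_{ij} over x ∈ 𝒳 equals min{ B, ⌊(Σ_i S_i)/2⌋, Σ_i S_i − max_i S_i }. -/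
open Finset

/-- Total number of units allocated over unordered pairs `i < j`. -/
def pairTotal (N : ℕ) (x : Fin N → Fin N → ℕ) : ℕ :=
  ∑ i : Fin N, ∑ j : Fin N, if i < j then x i j else 0

/-- Degree of the allocation at node `i`: `∑_{j<i} x_{ji} + ∑_{j>i} x_{ij}`. -/
def nodeDeg (N : ℕ) (x : Fin N → Fin N → ℕ) (i : Fin N) : ℕ :=
  (∑ j : Fin N, if j < i then x j i else 0) + (∑ j : Fin N, if i < j then x i j else 0)

lemma nodeDeg_eq (N : ℕ) (x : Fin N → Fin N → ℕ) (k : Fin N) :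
    nodeDeg N x k = ∑ i : Fin N, ∑ j : Fin N,
      ((if j = k then (if i < j then x i j else 0) else 0) +
        (if i = k then (if i < j then x i j else 0) else 0)) := by
  unfold nodeDeg
  simp only [Finset.sum_add_distrib]
  congr 1
  · simp
  · rw [Finset.sum_comm]
    simp

lemma sum_nodeDeg (N : ℕ) (x : Fin N → Fin N → ℕ) :
    ∑ k, nodeDeg N x k = 2 * pairTotal N x := by
  unfold nodeDeg pairTotal
  rw [Finset.sum_add_distrib, Finset.sum_comm, two_mul]

lemma nodeDeg_le (N : ℕ) (x : Fin N → Fin N → ℕ) (k : Fin N) :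
    nodeDeg N x k ≤ pairTotal N x := by
  rw [nodeDeg_eq]
  unfold pairTotal
  refine Finset.sum_le_sum fun i _ => Finset.sum_le_sum fun j _ => ?_
  by_cases h : i < j
  · have := h.ne
    by_cases h1 : i = k
    · have : j ≠ k := by rintro rfl; exact this h1
      simp [this]; split_ifs <;> simp
    · simp [h1]; split_ifs <;> simp
  · simp [h]

/-- Add one unit on the pair `(a, b)`. -/
def addUnit (N : ℕ) (x : Fin N → Fin N → ℕ) (a b : Fin N) : Fin N → Fin N → ℕ :=
  fun i j => x i j + if i = a then (if j = b then 1 else 0) else 0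

lemma addUnit_ite (N : ℕ) (x : Fin N → Fin N → ℕ) (a b : Fin N) (h : a < b) (i j : Fin N) :
    (if i < j then addUnit N x a b i j else 0) =
      (if i < j then x i j else 0) + if i = a then (if j = b then 1 else 0) else 0 := by
  unfold addUnit
  by_cases h1 : i = a
  · by_cases h2 : j = b
    · subst h1 h2; simp [h]
    · simp [h2]
  · simp [h1]

lemma pairTotal_addUnit (N : ℕ) (x : Fin N → Fin N → ℕ) (a b : Fin N) (h : a < b) :
    pairTotal N (addUnit N x a b) = pairTotal N x + 1 := by
  unfold pairTotal
  simp only [addUnit_ite N x a b h, Finset.sum_add_distrib]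
  simp

lemma nodeDeg_addUnit (N : ℕ) (x : Fin N → Fin N → ℕ) (a b : Fin N) (h : a < b) (k : Fin N) :
    nodeDeg N (addUnit N x a b) k =
      nodeDeg N x k + (if k = a then 1 else 0) + (if k = b then 1 else 0) := by
  unfold nodeDeg
  simp only [addUnit_ite N x a b h, Finset.sum_add_distrib]
  have h1 : (∑ j : Fin N, if j = a then (if k = b then 1 else 0) else 0) =
      if k = b then 1 else 0 := by simp
  have h2 : (∑ j : Fin N, if k = a then (if j = b then 1 else 0) else 0) =
      if k = a then 1 else 0 := by split_ifs <;> simp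
  rw [h1, h2]
  omega

lemma achieve (N : ℕ) (t : ℕ) : ∀ S : Fin N → ℕ, 2 * t ≤ ∑ i, S i →
    (∀ i, t + S i ≤ ∑ i, S i) →
    ∃ x : Fin N → Fin N → ℕ, (∀ i, nodeDeg N x i ≤ S i) ∧ pairTotal N x = t := by
  induction t with
  | zero => intro S _ _; exact ⟨fun _ _ => 0, by simp [nodeDeg], by simp [pairTotal]⟩
  | succ t ih =>
    intro S h2 hS
    have hne : (Finset.univ : Finset (Fin N)).Nonempty := by
      by_contra h
      rw [Finset.not_nonempty_iff_eq_empty] at h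
      rw [h] at h2; simp at h2
    obtain ⟨i, -, hi⟩ := Finset.exists_max_image Finset.univ S hne
    have hsi : S i + ∑ j ∈ Finset.univ.erase i, S j = ∑ j, S j :=
      Finset.add_sum_erase _ _ (Finset.mem_univ i)
    have hpos : 0 < ∑ j ∈ Finset.univ.erase i, S j := by have := hS i; omega
    have hne2 : (Finset.univ.erase i).Nonempty := by
      by_contra h
      rw [Finset.not_nonempty_iff_eq_empty] at h
      rw [h] at hpos; simp at hpos
    obtain ⟨j, hj, hjm⟩ := Finset.exists_max_image (Finset.univ.erase i) S hne2
    have hji : j ≠ i := Finset.ne_of_mem_erase hj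
    have hsj : S j + ∑ k ∈ (Finset.univ.erase i).erase j, S k = ∑ k ∈ Finset.univ.erase i, S k :=
      Finset.add_sum_erase _ _ hj
    have hj0 : 0 < S j := by
      by_contra h0
      have : ∑ k ∈ Finset.univ.erase i, S k = 0 :=
        Finset.sum_eq_zero fun k hk => by have := hjm k hk; omega
      omega
    have hij := hi j (Finset.mem_univ j)
    let S' : Fin N → ℕ := fun k => S k - (if k = i then 1 else 0) - (if k = j then 1 else 0)
    have hSS : ∀ k, S k = S' k + (if k = i then 1 else 0) + (if k = j then 1 else 0) := by
      intro k
      simp only [S']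
      by_cases h1 : k = i
      · subst h1; simp [hji.symm]; omega
      · by_cases h3 : k = j
        · subst h3; simp [h1]; omega
        · simp [h1, h3]
    have hsum : ∑ k, S k = ∑ k, S' k + 2 := by
      rw [Finset.sum_congr rfl fun k _ => hSS k]
      simp [Finset.sum_add_distrib]
    obtain ⟨x, hx, hxt⟩ := ih S' (by omega) (by
      intro k
      have hk := hS k
      have hk' := hSS k
      by_cases h1 : k = i
      · subst h1; simp [hji.symm] at hk'; omega
      · by_cases h3 : k = j
        · subst h3; simp [h1] at hk'; omega
        · simp [h1, h3] at hk'
          have hm : k ∈ (Finset.univ.erase i).erase j := by simp [h1, h3]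
          have hle := Finset.single_le_sum (f := S) (fun _ _ => Nat.zero_le _) hm
          have := hjm k (Finset.mem_of_mem_erase hm)
          omega)
    rcases lt_or_gt_of_ne hji with h | h
    · refine ⟨addUnit N x j i, fun k => ?_, by rw [pairTotal_addUnit N x j i h, hxt]⟩
      rw [nodeDeg_addUnit N x j i h, hSS k]
      have := hx k
      omega
    · refine ⟨addUnit N x i j, fun k => ?_, by rw [pairTotal_addUnit N x i j h, hxt]⟩
      rw [nodeDeg_addUnit N x i j h, hSS k]
      have := hx k
      omega

theorem stmt0 (N : ℕ) (hN : 2 ≤ N) (S : Fin N → ℕ) (B : ℕ) :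
    IsGreatest
      {t : ℕ | ∃ x : Fin N → Fin N → ℕ,
        pairTotal N x ≤ B ∧ (∀ i, nodeDeg N x i ≤ S i) ∧ t = pairTotal N x}
      (min B (min ((∑ i, S i) / 2) ((∑ i, S i) - Finset.univ.sup S))) := by
  have hsup : Finset.univ.sup S ≤ ∑ i, S i :=
    Finset.sup_le fun i hi => Finset.single_le_sum (f := S) (fun _ _ => Nat.zero_le _) hi
  constructor
  · obtain ⟨x, hx, hxt⟩ := achieve N
      (min B (min ((∑ i, S i) / 2) ((∑ i, S i) - Finset.univ.sup S))) S (by omega) (by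
        intro i
        have : S i ≤ Finset.univ.sup S := Finset.le_sup (Finset.mem_univ i)
        omega)
    exact ⟨x, by omega, hx, hxt.symm⟩
  · rintro t ⟨x, hB, hx, rfl⟩
    have h1 := sum_nodeDeg N x
    have h2 : ∑ k, nodeDeg N x k ≤ ∑ k, S k := Finset.sum_le_sum fun k _ => hx k
    obtain ⟨m, -, hm⟩ := Finset.exists_mem_eq_sup (Finset.univ : Finset (Fin N))
      ⟨⟨0, by omega⟩, Finset.mem_univ _⟩ S
    have h3 := Finset.add_sum_erase Finset.univ S (Finset.mem_univ m)
    have h4 := Finset.add_sum_erase Finset.univ (nodeDeg N x) (Finset.mem_univ m)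
    have h5 : ∑ k ∈ Finset.univ.erase m, nodeDeg N x k ≤ ∑ k ∈ Finset.univ.erase m, S k :=
      Finset.sum_le_sum fun k _ => hx k
    have h6 := nodeDeg_le N x m
    rw [hm]
    refine le_min hB (le_min ?_ ?_) <;> omega
end

section
/- Let N ≥ 2, let S_1,…,S_N and B be nonnegative integers, let 𝒳 = { x ∈ ℤ_{≥0}^ℱ : Σ_{i<j} x_{ij} ≤ B and Σ_{j≠i} x-degree at node i ≤ S_i for every i }, and let c > 0 be a real constant. Then the maximum of Σ_{i<j} λ_{ij} over vectors λ in the scaled convex hull c · conv(𝒳) ⊂ ℝ^ℱ equals c · min{ B, ⌊(Σ_i S_i)/2⌋, Σ_i S_i − max_i S_i }. -/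
open Finset Pointwise

/-- The index set ℱ of unordered node pairs `(i,j)` with `i < j`. -/
def Pairs (N : ℕ) : Type := {p : Fin N × Fin N // p.1 < p.2}

instance (N : ℕ) : Fintype (Pairs N) := by unfold Pairs; infer_instance

/-- Degree of an integer allocation at node `i`:
`∑_{j<i} x_{ji} + ∑_{j>i} x_{ij}` (each pair containing `i` contributes once). -/
def nodeDegP (N : ℕ) (x : Pairs N → ℕ) (i : Fin N) : ℕ :=
  ∑ p : Pairs N, if p.val.1 = i ∨ p.val.2 = i then x p else 0

/-- Embedding of integer allocations into ℝ^ℱ. -/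
def toRealVec (N : ℕ) (x : Pairs N → ℕ) : Pairs N → ℝ := fun p => (x p : ℝ)

noncomputable instance pairsDecEq (N : ℕ) : DecidableEq (Pairs N) := Classical.decEq _

lemma aux_sum_deg (N : ℕ) (x : Pairs N → ℕ) :
    ∑ i, nodeDegP N x i = 2 * ∑ p : Pairs N, x p := by
  unfold nodeDegP
  rw [Finset.sum_comm, Finset.mul_sum]
  refine Finset.sum_congr rfl fun p _ => ?_
  have hne : p.val.1 ≠ p.val.2 := ne_of_lt p.property
  have h : ∀ i : Fin N, (if p.val.1 = i ∨ p.val.2 = i then x p else 0)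
      = (if p.val.1 = i then x p else 0) + (if p.val.2 = i then x p else 0) := by
    intro i
    by_cases h1 : p.val.1 = i
    · have h2 : ¬ p.val.2 = i := fun h2 => hne (h1.trans h2.symm)
      simp [h1, h2]
    · simp [h1]
  simp only [h, Finset.sum_add_distrib, Finset.sum_ite_eq, Finset.mem_univ, if_true]
  ring

lemma aux_deg_le (N : ℕ) (x : Pairs N → ℕ) (i : Fin N) :
    nodeDegP N x i ≤ ∑ p : Pairs N, x p := by
  unfold nodeDegP
  refine Finset.sum_le_sum fun p _ => ?_
  split_ifs <;> simp

lemma aux_exists (N : ℕ) (hN : 2 ≤ N) (k : ℕ) : ∀ (S : Fin N → ℕ), 2 * k ≤ ∑ i, S i →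
    (∀ i, S i + k ≤ ∑ i, S i) →
    ∃ x : Pairs N → ℕ, ∑ p : Pairs N, x p = k ∧ ∀ i, nodeDegP N x i ≤ S i := by
  induction k with
  | zero => 
    intro S _ _
    exact ⟨fun _ => 0, by simp, by simp [nodeDegP]⟩
  | succ k ih =>
    intro S h1 h2
    obtain ⟨i, -, hi⟩ := Finset.exists_max_image univ S ⟨⟨0, by omega⟩, Finset.mem_univ _⟩
    have hsi := Finset.add_sum_erase univ S (Finset.mem_univ i)
    have hpos : 0 < ∑ l ∈ univ.erase i, S l := by have := h2 i; omega
    obtain ⟨j0, hj0, hj0p⟩ := Finset.sum_pos_iff.mp hpos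
    obtain ⟨j, hjm, hj⟩ := Finset.exists_max_image (univ.erase i) S ⟨j0, hj0⟩
    have hij : j ≠ i := Finset.ne_of_mem_erase hjm
    have hjp : 0 < S j := lt_of_lt_of_le hj0p (hj j0 hj0)
    have hip : 0 < S i := lt_of_lt_of_le hjp (hi j (Finset.mem_univ _))
    have hsj := Finset.add_sum_erase (univ.erase i) S hjm
    let d : Fin N → ℕ := fun l => if i = l ∨ j = l then 1 else 0
    let S' : Fin N → ℕ := fun l => S l - d l
    have hd : ∀ l, S' l + d l = S l := by
      intro l
      simp only [S', d]
      split_ifs with h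
      · rcases h with rfl | rfl <;> omega
      · rfl
    have hdsum : ∑ l, d l = 2 := by
      have : ∀ l, d l = (if i = l then 1 else 0) + (if j = l then 1 else 0) := by
        intro l
        simp only [d]
        by_cases h : i = l
        · have : ¬ j = l := fun h' => hij (h'.trans h.symm)
          simp [h, this]
        · simp [h]
      simp [this, Finset.sum_add_distrib]
    have hS' : ∑ l, S' l + 2 = ∑ l, S l := by
      rw [← hdsum, ← Finset.sum_add_distrib]
      exact Finset.sum_congr rfl fun l _ => hd l
    obtain ⟨x, hx, hxd⟩ := ih S' (by omega) (by
      intro l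
      have hl := hd l
      have h2l := h2 l
      by_cases h : i = l ∨ j = l
      · have : d l = 1 := by simp [d, h]
        omega
      · have hd0 : d l = 0 := by simp [d, h]
        push Not at h
        have hle : S l ≤ ∑ l ∈ (univ.erase i).erase j, S l :=
          Finset.single_le_sum (f := S) (fun _ _ => Nat.zero_le _) (by simp [h.1.symm, h.2.symm])
        have a1 := hj l (by simp [h.1.symm])
        have a2 := hi j (Finset.mem_univ _)
        have a3 := h2 i
        have a4 := h2 j
        omega)
    obtain ⟨p, hp⟩ : ∃ p : Pairs N, ∀ l, (p.val.1 = l ∨ p.val.2 = l) ↔ (i = l ∨ j = l) := by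
      rcases lt_or_gt_of_ne hij with h | h
      · exact ⟨⟨(j, i), h⟩, fun l => or_comm⟩
      · exact ⟨⟨(i, j), h⟩, fun l => Iff.rfl⟩
    refine ⟨fun q => x q + if p = q then 1 else 0, ?_, ?_⟩
    · simp [Finset.sum_add_distrib, hx]
    · intro l
      have : nodeDegP N (fun q => x q + if p = q then 1 else 0) l = nodeDegP N x l + d l := by
        unfold nodeDegP
        have e : ∀ q : Pairs N, (if q.val.1 = l ∨ q.val.2 = l then
            (x q + if p = q then 1 else 0) else 0) =
            (if q.val.1 = l ∨ q.val.2 = l then x q else 0) + (if p = q then d l else 0) := by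
          intro q
          by_cases hq : p = q
          · subst hq
            simp only [hp, d]
            split_ifs <;> simp
          · simp [hq]
        simp only [e, Finset.sum_add_distrib, Finset.sum_ite_eq, Finset.mem_univ, if_true]
      rw [this, ← hd l]
      exact Nat.add_le_add_right (hxd l) _

lemma aux_upper (N : ℕ) (S : Fin N → ℕ) (x : Pairs N → ℕ)
    (hx : ∀ i, nodeDegP N x i ≤ S i) (i : Fin N) :
    2 * (∑ p : Pairs N, x p) ≤ ∑ i, S i ∧ S i + ∑ p : Pairs N, x p ≤ ∑ i, S i := by
  have h := aux_sum_deg N x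
  have h1 : ∑ i, nodeDegP N x i ≤ ∑ i, S i := Finset.sum_le_sum fun i _ => hx i
  have h2 := Finset.add_sum_erase univ S (Finset.mem_univ i)
  have h3 := Finset.add_sum_erase univ (nodeDegP N x) (Finset.mem_univ i)
  have h4 : ∑ l ∈ univ.erase i, nodeDegP N x l ≤ ∑ l ∈ univ.erase i, S l :=
    Finset.sum_le_sum fun i _ => hx i
  have h5 := aux_deg_le N x i
  omega

theorem stmt1 (N : ℕ) (hN : 2 ≤ N) (S : Fin N → ℕ) (B : ℕ) (c : ℝ) (hc : 0 < c) :
    IsGreatest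
      {t : ℝ | ∃ lam ∈ c • convexHull ℝ
          (toRealVec N '' {x : Pairs N → ℕ |
            (∑ p : Pairs N, x p) ≤ B ∧ ∀ i, nodeDegP N x i ≤ S i}),
        t = ∑ p : Pairs N, lam p}
      (c * (min B (min ((∑ i, S i) / 2) ((∑ i, S i) - Finset.univ.sup S)) : ℕ)) := by
  obtain ⟨i0, -, hi0⟩ := Finset.exists_max_image univ S ⟨⟨0, by omega⟩, Finset.mem_univ _⟩
  have hsup : Finset.univ.sup S = S i0 :=
    le_antisymm (Finset.sup_le hi0) (Finset.le_sup (Finset.mem_univ i0))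
  have hle : S i0 ≤ ∑ i, S i :=
    Finset.single_le_sum (f := S) (fun _ _ => Nat.zero_le _) (Finset.mem_univ i0)
  rw [hsup]
  set m := min B (min ((∑ i, S i) / 2) ((∑ i, S i) - S i0)) with hm
  constructor
  · obtain ⟨x, hx, hxd⟩ := aux_exists N hN m S (by omega) (by
      intro i
      have := hi0 i (Finset.mem_univ _)
      omega)
    refine ⟨c • toRealVec N x, Set.smul_mem_smul_set (subset_convexHull ℝ _
      ⟨x, ⟨by omega, hxd⟩, rfl⟩), ?_⟩
    simp only [Pi.smul_apply, smul_eq_mul, ← Finset.mul_sum, toRealVec]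
    rw [← hx]
    push_cast
    rfl
  · rintro t ⟨lam, hlam, rfl⟩
    obtain ⟨v, hv, rfl⟩ := Set.mem_smul_set.mp hlam
    simp only [Pi.smul_apply, smul_eq_mul, ← Finset.mul_sum]
    refine mul_le_mul_of_nonneg_left ?_ hc.le
    have hconv : Convex ℝ {v : Pairs N → ℝ | ∑ p, v p ≤ (m : ℝ)} := by
      refine convex_halfSpace_le ⟨fun a b => ?_, fun a b => ?_⟩ _
      · simp [Finset.sum_add_distrib]
      · simp [Finset.mul_sum]
    refine convexHull_min ?_ hconv hv
    rintro _ ⟨x, ⟨hxB, hxd⟩, rfl⟩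
    have := aux_upper N S x hxd i0
    have hxm : ∑ p : Pairs N, x p ≤ m := by omega
    simp only [Set.mem_setOf_eq, toRealVec]
    exact_mod_cast hxm
end

section
/- Let N ≥ 2 and let S_1,…,S_N be nonnegative integers with T = Σ_i S_i. Then the maximum of Σ_{i<j} x_{ij} over all vectors x ∈ ℤ_{≥0}^ℱ satisfying the degree constraints Σ_{j<i} x_{ji} + Σ_{j>i} x_{ij} ≤ S_i for every node i (with no global budget constraint) equals min{ ⌊T/2⌋, T − max_i S_i }. -/
open Finset

theorem sum_nodeDeg_aux (N : ℕ) (x : Fin N → Fin N → ℕ) :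
    ∑ i, nodeDeg N x i = 2 * pairTotal N x := by
  unfold nodeDeg pairTotal
  rw [Finset.sum_add_distrib, Finset.sum_comm, two_mul]

theorem nodeDeg_le_aux (N : ℕ) (x : Fin N → Fin N → ℕ) (i : Fin N) :
    nodeDeg N x i ≤ pairTotal N x := by
  have h : ∀ a : Fin N, (if a < i then x a i else 0) +
      (if a = i then (∑ k : Fin N, if i < k then x i k else 0) else 0) ≤
      ∑ k : Fin N, if a < k then x a k else 0 := by
    intro a
    by_cases ha : a = i
    · subst ha; simp
    · simp only [ha, if_false, add_zero]
      exact Finset.single_le_sum (f := fun k => if a < k then x a k else 0)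
        (fun _ _ => Nat.zero_le _) (Finset.mem_univ i)
  have h2 := Finset.sum_le_sum (s := Finset.univ) (fun a _ => h a)
  rw [Finset.sum_add_distrib] at h2
  simpa [nodeDeg, pairTotal] using h2

/-- The allocation consisting of the single edge `a < b`. -/
def oneEdge (N : ℕ) (a b : Fin N) : Fin N → Fin N → ℕ :=
  fun i j => if i = a ∧ j = b then 1 else 0

theorem pairTotal_add_aux (N : ℕ) (x y : Fin N → Fin N → ℕ) :
    pairTotal N (fun i j => x i j + y i j) = pairTotal N x + pairTotal N y := by
  unfold pairTotal
  simp only [← Finset.sum_add_distrib]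
  refine Finset.sum_congr rfl fun i _ => Finset.sum_congr rfl fun j _ => ?_
  split_ifs <;> rfl

theorem nodeDeg_add_aux (N : ℕ) (x y : Fin N → Fin N → ℕ) (i : Fin N) :
    nodeDeg N (fun i j => x i j + y i j) i = nodeDeg N x i + nodeDeg N y i := by
  unfold nodeDeg
  simp only [← Finset.sum_add_distrib]
  refine Finset.sum_congr rfl fun j _ => ?_
  split_ifs <;> omega

theorem pairTotal_oneEdge (N : ℕ) (a b : Fin N) (h : a < b) :
    pairTotal N (oneEdge N a b) = 1 := by
  unfold pairTotal oneEdge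
  rw [Finset.sum_eq_single a, Finset.sum_eq_single b]
  · simp [h]
  · intro j _ hj; simp [hj]
  · simp
  · intro j _ hj; simp [hj]
  · simp

theorem nodeDeg_oneEdge (N : ℕ) (a b : Fin N) (h : a < b) (i : Fin N) :
    nodeDeg N (oneEdge N a b) i = (if i = b then 1 else 0) + (if i = a then 1 else 0) := by
  unfold nodeDeg oneEdge
  congr 1
  · rw [Finset.sum_eq_single a]
    · by_cases hi : i = b
      · subst hi; simp [h]
      · simp [hi]
    · intro j _ hj; simp [hj]
    · simp
  · rw [Finset.sum_eq_single b]
    · by_cases hi : i = a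
      · subst hi; simp [h]
      · simp [hi]
    · intro j _ hj; simp [hj]
    · simp

theorem exists_edge_aux (N : ℕ) (a b : Fin N) (h : a ≠ b) :
    ∃ y : Fin N → Fin N → ℕ, pairTotal N y = 1 ∧
      ∀ i, nodeDeg N y i = (if i = a then 1 else 0) + (if i = b then 1 else 0) := by
  rcases lt_or_gt_of_ne h with h | h
  · exact ⟨_, pairTotal_oneEdge N a b h, fun i => by rw [nodeDeg_oneEdge N a b h, add_comm]⟩
  · exact ⟨_, pairTotal_oneEdge N b a h, fun i => by rw [nodeDeg_oneEdge N b a h]⟩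

theorem achieve_aux (N : ℕ) (hN : 2 ≤ N) (k : ℕ) : ∀ (S : Fin N → ℕ),
    2 * k ≤ ∑ i, S i → (∀ i, k + S i ≤ ∑ i, S i) →
    ∃ x : Fin N → Fin N → ℕ, (∀ i, nodeDeg N x i ≤ S i) ∧ pairTotal N x = k := by
  induction k with
  | zero =>
    intro S _ _
    exact ⟨fun _ _ => 0, by simp [nodeDeg], by simp [pairTotal]⟩
  | succ k ih =>
    intro S h1 h2
    obtain ⟨a, -, ha⟩ := Finset.exists_max_image (Finset.univ : Finset (Fin N)) S
      ⟨⟨0, by omega⟩, Finset.mem_univ _⟩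
    have hsa := Finset.add_sum_erase Finset.univ S (Finset.mem_univ a)
    have hane : (Finset.univ.erase a).Nonempty := by
      rw [← Finset.card_pos, Finset.card_erase_of_mem (Finset.mem_univ a)]
      simp; omega
    obtain ⟨b, hbm, hb⟩ := Finset.exists_max_image (Finset.univ.erase a) S hane
    have hba : b ≠ a := (Finset.mem_erase.1 hbm).1
    have hsb := Finset.add_sum_erase (Finset.univ.erase a) S hbm
    have hab := ha b (Finset.mem_univ b)
    have hb1 : 1 ≤ S b := by
      by_contra hc
      have : ∑ i ∈ Finset.univ.erase a, S i = 0 :=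
        Finset.sum_eq_zero fun i hi => by have := hb i hi; omega
      have := h2 a
      omega
    obtain ⟨y, hy1, hy2⟩ := exists_edge_aux N a b hba.symm
    have hyS : ∀ i, nodeDeg N y i ≤ S i := by
      intro i
      rw [hy2]
      by_cases h : i = a
      · subst h; simp [hba.symm]; omega
      · by_cases h' : i = b
        · subst h'; simp [h]; omega
        · simp [h, h']
    have hsum : ∑ i, (S i - nodeDeg N y i) + 2 = ∑ i, S i := by
      have h3 := sum_nodeDeg_aux N y
      rw [hy1] at h3
      have : ∑ i, (S i - nodeDeg N y i) + ∑ i, nodeDeg N y i = ∑ i, S i := by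
        rw [← Finset.sum_add_distrib]
        exact Finset.sum_congr rfl fun i _ => Nat.sub_add_cancel (hyS i)
      omega
    obtain ⟨x, hx1, hx2⟩ := ih (fun i => S i - nodeDeg N y i) (by omega) (by
      intro i
      have h2i := h2 i
      show k + (S i - nodeDeg N y i) ≤ ∑ i, (S i - nodeDeg N y i)
      have hyi := hyS i
      have hy2i := hy2 i
      by_cases h : i = a
      · rw [if_pos h] at hy2i; omega
      · by_cases h' : i = b
        · rw [if_pos h'] at hy2i; omega
        · have hi1 : i ∈ Finset.univ.erase a := by simp [h]
          have hi2 : i ∈ (Finset.univ.erase a).erase b := by simp [h, h']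
          have hi3 := Finset.single_le_sum (f := S) (fun _ _ => Nat.zero_le _) hi2
          have hi4 := hb i hi1
          omega)
    refine ⟨fun i j => x i j + y i j, fun i => ?_, ?_⟩
    · rw [nodeDeg_add_aux]
      have := hx1 i
      have := hyS i
      omega
    · rw [pairTotal_add_aux, hx2, hy1]

theorem stmt4 (N : ℕ) (hN : 2 ≤ N) (S : Fin N → ℕ) :
    IsGreatest
      {t : ℕ | ∃ x : Fin N → Fin N → ℕ,
        (∀ i, nodeDeg N x i ≤ S i) ∧ t = pairTotal N x}
      (min ((∑ i, S i) / 2) ((∑ i, S i) - Finset.univ.sup S)) := by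
  constructor
  · obtain ⟨x, hx, hx'⟩ := achieve_aux N hN
      (min ((∑ i, S i) / 2) ((∑ i, S i) - Finset.univ.sup S)) S (by omega) (by
        intro i
        have h1 : S i ≤ Finset.univ.sup S := Finset.le_sup (Finset.mem_univ i)
        have h2 : Finset.univ.sup S ≤ ∑ i, S i := Finset.sup_le fun j _ =>
          Finset.single_le_sum (f := S) (fun _ _ => Nat.zero_le _) (Finset.mem_univ j)
        omega)
    exact ⟨x, hx, hx'.symm⟩
  · rintro t ⟨x, hx, rfl⟩
    have h1 := sum_nodeDeg_aux N x
    have h2 : ∑ i, nodeDeg N x i ≤ ∑ i, S i := Finset.sum_le_sum fun i _ => hx i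
    have h3 : Finset.univ.sup S ≤ (∑ i, S i) - pairTotal N x := Finset.sup_le fun i _ => by
      have h4 := Finset.add_sum_erase Finset.univ S (Finset.mem_univ i)
      have h5 := Finset.add_sum_erase Finset.univ (nodeDeg N x) (Finset.mem_univ i)
      have h6 : ∑ j ∈ Finset.univ.erase i, nodeDeg N x j ≤ ∑ j ∈ Finset.univ.erase i, S j :=
        Finset.sum_le_sum fun i _ => hx i
      have h7 := nodeDeg_le_aux N x i
      omega
    omega
end

section
/- Let d ≥ 1 and let Λ ⊂ ℝ^d be a nonempty convex set such that P x ∈ Λ for every x ∈ Λ and every d × d permutation matrix P. Suppose S* = max_{x ∈ Λ} Σ_{k=1}^d x_k is finite and attained. Then max{ κ ∈ ℝ : κ·𝟙 ∈ Λ } = S*/d, where 𝟙 ∈ ℝ^d is the all-ones vector. -/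
open Finset

theorem stmt9 (d : ℕ) (hd : 1 ≤ d) (Λ : Set (Fin d → ℝ))
    (hne : Λ.Nonempty) (hconv : Convex ℝ Λ)
    (hperm : ∀ x ∈ Λ, ∀ σ : Equiv.Perm (Fin d), (x ∘ σ) ∈ Λ)
    (S : ℝ) (hS : IsGreatest {s : ℝ | ∃ x ∈ Λ, s = ∑ k, x k} S) :
    IsGreatest {κ : ℝ | (fun _ : Fin d => κ) ∈ Λ} (S / d) := by
  haveI : NeZero d := ⟨by omega⟩
  have hd0 : (0 : ℝ) < d := by exact_mod_cast hd
  obtain ⟨⟨x, hx, hxS⟩, hub⟩ := hS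
  constructor
  · have h := hconv.sum_mem (t := (Finset.univ : Finset (Fin d)))
      (w := fun _ => (d : ℝ)⁻¹) (z := fun j => x ∘ (Equiv.addLeft j))
      (fun _ _ => by positivity)
      (by simp [hd0.ne'])
      (fun j _ => hperm x hx _)
    have e : (∑ j : Fin d, (d : ℝ)⁻¹ • (x ∘ (Equiv.addLeft j))) = fun _ : Fin d => S / d := by
      funext k
      have hk : ∑ j : Fin d, x (j + k) = ∑ j, x j :=
        Equiv.sum_comp (Equiv.addRight k) x
      simp only [Finset.sum_apply, Pi.smul_apply, Function.comp_apply, Equiv.coe_addLeft,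
        smul_eq_mul]
      rw [← Finset.mul_sum, hk, ← hxS, div_eq_inv_mul]
    rw [e] at h
    exact h
  · intro κ hκ
    have h := hub ⟨_, hκ, rfl⟩
    rw [le_div_iff₀ hd0]
    simpa [mul_comm] using h
end

section
/- Let N ≥ 2, let S and B be nonnegative integers, and set S_i = S for every node i (homogeneous switch). Let 𝒳 = { x ∈ ℤ_{≥0}^ℱ : Σ_{i<j} x_{ij} ≤ B and node-degree of x at i ≤ S for all i }, let c > 0, let Λ = c · conv(𝒳), and let F = N(N−1)/2. Then max{ κ ∈ ℝ : κ·𝟙 ∈ Λ } = (1/F) · max_{λ ∈ Λ} Σ_{i<j} λ_{ij} = (c/F) · min{ B, ⌊NS/2⌋, (N−1)S }. -/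
open Finset Pointwise

lemma pairs_ext {N : ℕ} (p q : Pairs N)
    (h : ∀ j, (p.val.1 = j ∨ p.val.2 = j) ↔ (q.val.1 = j ∨ q.val.2 = j)) : p = q := by
  obtain ⟨⟨a, b⟩, hp⟩ := p
  obtain ⟨⟨c, d⟩, hq⟩ := q
  simp only at h hp hq
  have h1 := (h a).1 (Or.inl rfl)
  have h2 := (h b).1 (Or.inr rfl)
  have h3 := (h c).2 (Or.inl rfl)
  have h4 := (h d).2 (Or.inr rfl)
  clear h
  have : a = c ∧ b = d := by
    simp only [Fin.ext_iff, Fin.lt_def] at *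
    omega
  obtain ⟨rfl, rfl⟩ := this
  rfl

lemma exists_pair {N : ℕ} (a b : Fin N) (hab : a ≠ b) :
    ∃ p : Pairs N, ∀ j, (p.val.1 = j ∨ p.val.2 = j) ↔ (a = j ∨ b = j) := by
  rcases lt_or_gt_of_ne hab with h | h
  · exact ⟨⟨(a, b), h⟩, fun j => Iff.rfl⟩
  · exact ⟨⟨(b, a), h⟩, fun j => or_comm⟩

lemma exists_act {N : ℕ} (σ : Equiv.Perm (Fin N)) :
    ∃ e : Pairs N ≃ Pairs N, ∀ p j, ((e p).val.1 = j ∨ (e p).val.2 = j) ↔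
      (σ p.val.1 = j ∨ σ p.val.2 = j) := by
  have h : ∀ p : Pairs N, ∃ q : Pairs N, ∀ j, (q.val.1 = j ∨ q.val.2 = j) ↔
      (σ p.val.1 = j ∨ σ p.val.2 = j) := fun p =>
    exists_pair _ _ (fun h => p.2.ne (σ.injective h))
  choose f hf using h
  have hinj : Function.Injective f := by
    intro p q hpq
    apply pairs_ext
    intro j
    have h1 := hf p (σ j)
    have h2 := hf q (σ j)
    rw [hpq] at h1
    simp only [σ.injective.eq_iff] at h1 h2
    exact h1.symm.trans h2
  exact ⟨Equiv.ofBijective f (Finite.injective_iff_bijective.mp hinj), hf⟩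

lemma exists_perm {N : ℕ} (a b c d : Fin N) (hab : a ≠ b) (hcd : c ≠ d) :
    ∃ τ : Equiv.Perm (Fin N), τ a = c ∧ τ b = d := by
  refine ⟨Equiv.swap (Equiv.swap a c b) d * Equiv.swap a c, ?_, ?_⟩
  · rw [Equiv.Perm.mul_apply, Equiv.swap_apply_left]
    apply Equiv.swap_apply_of_ne_of_ne _ hcd
    intro h
    have := Equiv.swap_apply_left a c
    exact hab ((Equiv.swap a c).injective (this.trans h))
  · rw [Equiv.Perm.mul_apply, Equiv.swap_apply_left]

lemma card_pairs (N : ℕ) : Fintype.card (Pairs N) = N * (N - 1) / 2 := by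
  have h : Fintype.card (Pairs N) = Fintype.card (Σ i : Fin N, {j : Fin N // i < j}) :=
    Fintype.card_congr
      { toFun := fun p => ⟨p.val.1, p.val.2, p.2⟩
        invFun := fun s => ⟨(s.1, s.2.1), s.2.2⟩
        left_inv := fun p => rfl
        right_inv := fun s => rfl }
  rw [h, Fintype.card_sigma]
  have : ∀ i : Fin N, Fintype.card {j : Fin N // i < j} = N - 1 - i := by
    intro i
    rw [← Fin.card_Ioi, Fintype.card_subtype]
    congr 1
    ext j
    simp
  simp only [this]
  rw [Fin.sum_univ_eq_sum_range (fun i => N - 1 - i) N,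
    Finset.sum_range_reflect (fun i => i) N, Finset.sum_range_id]

lemma sum_deg (N : ℕ) (x : Pairs N → ℕ) : ∑ i, nodeDegP N x i = 2 * ∑ p, x p := by
  unfold nodeDegP
  rw [Finset.sum_comm, Finset.mul_sum]
  refine Finset.sum_congr rfl fun p _ => ?_
  have : ∀ i, (if p.val.1 = i ∨ p.val.2 = i then x p else 0) =
      (if p.val.1 = i then x p else 0) + (if p.val.2 = i then x p else 0) := by
    intro i
    have := p.2.ne
    by_cases h1 : p.val.1 = i <;> by_cases h2 : p.val.2 = i <;> simp [h1, h2]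
    exact absurd (h1.trans h2.symm) this
  simp only [this, Finset.sum_add_distrib, Finset.sum_ite_eq, Finset.mem_univ, if_true]
  ring

lemma exists_alloc (N : ℕ) (hN : 2 ≤ N) (S m : ℕ) (hm : 2 * m ≤ N * S) :
    ∃ x : Pairs N → ℕ, ∑ p, x p = m ∧ ∀ i, nodeDegP N x i ≤ S := by
  classical
  have hpos : 0 < N := by omega
  let nd : ℕ → Fin N := fun t => ⟨t % N, Nat.mod_lt _ hpos⟩
  have hne : ∀ t, nd t ≠ nd (t + 1) := by
    intro t h
    have h1 : t % N = (t + 1) % N := congrArg Fin.val h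
    have h2 : (t + 0) ≡ t + 1 [MOD N] := h1
    have h3 := Nat.ModEq.add_left_cancel' t h2
    unfold Nat.ModEq at h3
    rw [Nat.mod_eq_of_lt (by omega : 1 < N)] at h3
    simp at h3
  choose e he using fun k : ℕ => exists_pair (nd (2 * k)) (nd (2 * k + 1)) (hne _)
  refine ⟨fun p => ∑ k ∈ range m, if e k = p then 1 else 0, ?_, ?_⟩
  · rw [Finset.sum_comm]; simp
  · intro i
    have hd : nodeDegP N (fun p => ∑ k ∈ range m, if e k = p then 1 else 0) i
        = ∑ k ∈ range m, if nd (2*k) = i ∨ nd (2*k+1) = i then 1 else 0 := by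
      unfold nodeDegP
      have : ∀ p : Pairs N, (if p.val.1 = i ∨ p.val.2 = i then
          (∑ k ∈ range m, if e k = p then 1 else 0) else 0) =
          ∑ k ∈ range m, if e k = p then (if p.val.1 = i ∨ p.val.2 = i then 1 else 0) else 0 := by
        intro p
        split_ifs <;> simp
      simp only [this]
      rw [Finset.sum_comm]
      refine Finset.sum_congr rfl fun k _ => ?_
      rw [Finset.sum_ite_eq]
      simp only [Finset.mem_univ, if_true, he]
    rw [hd]
    have h2 : ∀ m, ∑ k ∈ range m, (if nd (2*k) = i ∨ nd (2*k+1) = i then 1 else 0)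
        = ∑ t ∈ range (2*m), if nd t = i then 1 else 0 := by
      intro m
      induction m with
      | zero => simp
      | succ m ih =>
        rw [Finset.sum_range_succ, ih, show 2 * (m+1) = 2*m+1+1 by ring,
          Finset.sum_range_succ, Finset.sum_range_succ, add_assoc]
        congr 1
        have := hne (2*m)
        by_cases h1 : nd (2*m) = i <;> by_cases h2 : nd (2*m+1) = i <;> simp [h1, h2]
        exact this (h1.trans h2.symm)
    rw [h2, ← Finset.card_filter]
    calc _ ≤ (range S).card := by
          apply Finset.card_le_card_of_injOn (fun t => t / N)
          · intro t ht
            simp only [coe_filter, Finset.mem_range, Set.mem_ofPred_eq] at ht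
            simp only [coe_range, Set.mem_Iio]
            exact Nat.div_lt_of_lt_mul (by omega)
          · intro s hs t ht hst
            simp only [coe_filter, Finset.mem_range, Set.mem_ofPred_eq] at hs ht
            have h : s % N = t % N := congrArg Fin.val (hs.2.trans ht.2.symm)
            have hst' : s / N = t / N := hst
            rw [← Nat.div_add_mod s N, ← Nat.div_add_mod t N, h, hst']
      _ = S := by simp

lemma deg_act {N : ℕ} (σ : Equiv.Perm (Fin N)) (e : Pairs N ≃ Pairs N)
    (he : ∀ p j, ((e p).val.1 = j ∨ (e p).val.2 = j) ↔ (σ p.val.1 = j ∨ σ p.val.2 = j))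
    (x : Pairs N → ℕ) (i : Fin N) :
    nodeDegP N (fun p => x (e p)) i = nodeDegP N x (σ i) := by
  unfold nodeDegP
  rw [← Equiv.sum_comp e (fun p => if p.val.1 = σ i ∨ p.val.2 = σ i then x p else 0)]
  refine Finset.sum_congr rfl fun p _ => ?_
  simp only [he, σ.injective.eq_iff]

theorem stmt11 (N : ℕ) (hN : 2 ≤ N) (S B : ℕ) (c : ℝ) (hc : 0 < c)
    (Λ : Set (Pairs N → ℝ))
    (hΛ : Λ = c • convexHull ℝ
      (toRealVec N '' {x : Pairs N → ℕ |
        (∑ p : Pairs N, x p) ≤ B ∧ ∀ i, nodeDegP N x i ≤ S}))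
    (F : ℕ) (hF : F = N * (N - 1) / 2) :
    IsGreatest {κ : ℝ | (fun _ : Pairs N => κ) ∈ Λ}
      ((c / F) * (min B (min (N * S / 2) ((N - 1) * S)) : ℕ)) ∧
    IsGreatest {t : ℝ | ∃ lam ∈ Λ, t = ∑ p : Pairs N, lam p}
      (c * (min B (min (N * S / 2) ((N - 1) * S)) : ℕ)) := by
  classical
  set M : ℕ := min B (min (N * S / 2) ((N - 1) * S)) with hM
  set X : Set (Pairs N → ℕ) := {x : Pairs N → ℕ |
        (∑ p : Pairs N, x p) ≤ B ∧ ∀ i, nodeDegP N x i ≤ S} with hX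
  have hcard : Fintype.card (Pairs N) = F := by rw [hF, card_pairs]
  have hFpos : 0 < F := by
    rw [← hcard]
    exact Fintype.card_pos_iff.mpr ⟨⟨(⟨0, by omega⟩, ⟨1, by omega⟩), by simp [Fin.lt_def]⟩⟩
  have hFR : (0 : ℝ) < F := by exact_mod_cast hFpos
  -- upper bound
  have hup : ∀ lam ∈ Λ, ∑ p, lam p ≤ c * M := by
    intro lam hlam
    rw [hΛ] at hlam
    obtain ⟨y, hy, rfl⟩ := hlam
    have hsub : convexHull ℝ (toRealVec N '' X) ⊆ {y | ∑ p, y p ≤ (M : ℝ)} := by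
      apply convexHull_min
      · rintro _ ⟨x, hx, rfl⟩
        have h1 : ∑ p, x p ≤ M := by
          have h2 := sum_deg N x
          have h3 : ∑ i, nodeDegP N x i ≤ N * S := by
            calc _ ≤ ∑ _i : Fin N, S := Finset.sum_le_sum fun i _ => hx.2 i
              _ = N * S := by simp
          have h4 : N * S ≤ 2 * ((N - 1) * S) := by
            rw [← mul_assoc]
            exact Nat.mul_le_mul_right _ (by omega)
          have h5 := hx.1
          omega
        simp only [Set.mem_ofPred_eq, toRealVec]
        exact_mod_cast h1
      · intro u hu v hv a b ha hb hab
        simp only [Set.mem_ofPred_eq, Pi.add_apply, Pi.smul_apply, smul_eq_mul,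
          Finset.sum_add_distrib, ← Finset.mul_sum] at *
        calc _ ≤ a * M + b * M := by gcongr
          _ = M := by rw [← add_mul, hab, one_mul]
    have := hsub hy
    simp only [Set.mem_ofPred_eq] at this
    simp only [Pi.smul_apply, smul_eq_mul, ← Finset.mul_sum]
    gcongr
  -- achievability
  obtain ⟨x, hxs, hxd⟩ := exists_alloc N hN S M (by omega)
  choose e he using fun σ : Equiv.Perm (Fin N) => exists_act σ
  have hmem : ∀ σ, toRealVec N (fun p => x (e σ p)) ∈ convexHull ℝ (toRealVec N '' X) := by
    intro σ
    apply subset_convexHull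
    refine ⟨_, ⟨?_, fun i => ?_⟩, rfl⟩
    · rw [Equiv.sum_comp (e σ) x, hxs]; omega
    · rw [deg_act σ (e σ) (he σ)]; exact hxd _
  have hGpos : (0 : ℝ) < Fintype.card (Equiv.Perm (Fin N)) := by
    exact_mod_cast Fintype.card_pos
  set G : ℝ := (Fintype.card (Equiv.Perm (Fin N)) : ℝ) with hG
  let y : Pairs N → ℝ := ∑ σ : Equiv.Perm (Fin N), G⁻¹ • toRealVec N (fun p => x (e σ p))
  have hy : y ∈ convexHull ℝ (toRealVec N '' X) := by
    apply (convex_convexHull ℝ _).sum_mem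
    · intro σ _; positivity
    · simp only [Finset.sum_const, nsmul_eq_mul, Finset.card_univ]
      exact mul_inv_cancel₀ hGpos.ne'
    · intro σ _; exact hmem σ
  have hyv : ∀ p, y p = ∑ σ, G⁻¹ * (x (e σ p) : ℝ) := by
    intro p
    simp only [y, Finset.sum_apply, Pi.smul_apply, smul_eq_mul, toRealVec]
  have hconst : ∀ p q, y p = y q := by
    intro p q
    obtain ⟨τ, h1, h2⟩ := exists_perm p.val.1 p.val.2 q.val.1 q.val.2 p.2.ne q.2.ne
    rw [hyv, hyv, ← Equiv.sum_comp (Equiv.mulRight τ)]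
    refine Finset.sum_congr rfl fun σ _ => ?_
    have : e (Equiv.mulRight τ σ) p = e σ q := by
      apply pairs_ext
      intro j
      rw [he, he]
      simp [h1, h2]
    rw [this]
  have hysum : ∑ p, y p = M := by
    simp only [hyv]
    rw [Finset.sum_comm]
    have : ∀ σ, ∑ p, G⁻¹ * (x (e σ p) : ℝ) = G⁻¹ * M := by
      intro σ
      rw [← Finset.mul_sum, Equiv.sum_comp (e σ) (fun p => (x p : ℝ)), ← hxs]
      push_cast; rfl
    simp only [this, Finset.sum_const, nsmul_eq_mul, Finset.card_univ]
    rw [← mul_assoc, ← hG, mul_inv_cancel₀ hGpos.ne', one_mul]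
  have hyM : ∀ p, y p = M / F := by
    intro p
    have h : ∑ q, y q = F * y p := by
      rw [Finset.sum_congr rfl fun q _ => hconst q p]
      simp [hcard]
    rw [hysum] at h
    field_simp
    linarith
  have hcy : c • y ∈ Λ := by
    rw [hΛ]; exact Set.smul_mem_smul_set hy
  refine ⟨⟨?_, ?_⟩, ⟨?_, ?_⟩⟩
  · have : (fun _ : Pairs N => (c / F) * (M : ℝ)) = c • y := by
      funext p
      rw [Pi.smul_apply, hyM, smul_eq_mul]; ring
    simp only [Set.mem_ofPred_eq]
    rw [this]; exact hcy
  · intro κ hκ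
    have := hup _ hκ
    simp only [Finset.sum_const, nsmul_eq_mul, Finset.card_univ, hcard] at this
    rw [div_mul_eq_mul_div, le_div_iff₀ hFR]
    linarith
  · refine ⟨_, hcy, ?_⟩
    simp only [Pi.smul_apply, smul_eq_mul, ← Finset.mul_sum, hysum]
  · rintro t ⟨lam, hl, rfl⟩
    exact hup lam hl
end
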